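/- arXiv:math/9910148 — 2 statements merged into one kernel-verified Lean document; each statement's English description precedes it below -/
import Mathlib

section
/- The 𝕜-linear map V_r ⊕ V_{r−1} ⊕ ⋯ ⊕ V₁ → V_r / range 𝐃 sending (w_r, w_{r−1}, …, w₁) to the class of w_r + Σ_{i=1}^{r−1} (D_{r−1} ∘ D_{r−2} ∘ ⋯ ∘ Dᵢ)(wᵢ) is surjective with kernel exactly range D̂, and hence induces a 𝕜-linear isomorphism of cokernels (V_r ⊕ V_{r−1} ⊕ ⋯ ⊕ V₁) / range D̂ ≅ V_r / range 𝐃. -/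
namespace RelZeta

variable (𝕜 : Type*) [Field 𝕜] (r : ℕ) (V : ℕ → Type*)
  [∀ i, AddCommGroup (V i)] [∀ i, Module 𝕜 (V i)]
  (D : ∀ i : ℕ, V i →ₗ[𝕜] V (i + 1))

/-- `Comp 𝕜 V D i = Dᵢ₋₁ ∘ ⋯ ∘ D₀ : V₀ → Vᵢ` (with `Comp 0 = id`);
`Comp 𝕜 V D r` is the `r`-th order operator `𝐃`. -/
def Comp : ∀ i : ℕ, V 0 →ₗ[𝕜] V i
  | 0 => LinearMap.id
  | (i + 1) => (D i).comp (Comp i)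

/-- The doubled-up first-order operator `D̂ : V₀ ⊕ ⋯ ⊕ V_{r-1} → V_r ⊕ ⋯ ⊕ V₁`.
The component of index `j : Fin r` of the codomain is `V (j+1)`; for `j+1 = r` it is
`D_{r-1} s_{r-1}`, and for `1 ≤ j+1 ≤ r-1` it is `D_j s_j − s_{j+1}`
(i.e. in the paper's indexing, the `V_j`-component is `D_{j-1} s_{j-1} − s_j`). -/
def Dhat : (∀ i : Fin r, V i) →ₗ[𝕜] (∀ j : Fin r, V ((j : ℕ) + 1)) where
  toFun s := fun j =>
    D j (s j) - (if h : (j : ℕ) + 1 < r then s ⟨(j : ℕ) + 1, h⟩ else 0)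
  map_add' s t := by
    funext j
    by_cases h : (j : ℕ) + 1 < r
    · simp [h]; abel
    · simp [h]
  map_smul' c s := by
    funext j
    by_cases h : (j : ℕ) + 1 < r <;> simp [h, smul_sub]

/-- Cast along an equality of indices. -/
def vcast {a b : ℕ} (h : a = b) : V a ≃ₗ[𝕜] V b := by
  subst h; exact LinearEquiv.refl 𝕜 (V a)

/-- `Tail 𝕜 r V D i = D_{r-1} ∘ D_{r-2} ∘ ⋯ ∘ Dᵢ : Vᵢ → V_r` (with `Tail r = id`). -/
def Tail : (i : ℕ) → V i →ₗ[𝕜] V r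
  | i =>
    if h : i < r then (Tail (i + 1)).comp (D i)
    else if h2 : i = r then (vcast 𝕜 V h2).toLinearMap else 0
  termination_by i => r - i
  decreasing_by omega

/-- The map `(w_r, w_{r-1}, …, w₁) ↦ w_r + ∑_{i=1}^{r-1} (D_{r-1} ∘ ⋯ ∘ Dᵢ)(wᵢ)`
(recall that the component of index `j : Fin r` is `w_{j+1} ∈ V (j+1)`, and
`Tail r = id` contributes the `w_r` term). -/
noncomputable def SumMap : (∀ j : Fin r, V ((j : ℕ) + 1)) →ₗ[𝕜] V r :=
  ∑ j : Fin r, (Tail 𝕜 r V D ((j : ℕ) + 1)).comp (LinearMap.proj j)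

theorem tail_of_lt {i : ℕ} (h : i < r) :
    Tail 𝕜 r V D i = (Tail 𝕜 r V D (i + 1)).comp (D i) := by
  rw [Tail, dif_pos h]

theorem tail_self : Tail 𝕜 r V D r = LinearMap.id := by
  rw [Tail, dif_neg (lt_irrefl r), dif_pos rfl]
  rfl

theorem tail_comp_comp {i : ℕ} (h : i ≤ r) :
    (Tail 𝕜 r V D i).comp (Comp 𝕜 V D i) = Comp 𝕜 V D r := by
  induction h using Nat.decreasingInduction with
  | self => rw [tail_self, LinearMap.id_comp]
  | of_succ i h ih => rw [← ih, tail_of_lt 𝕜 r V D h]; rfl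

theorem tail_zero : Tail 𝕜 r V D 0 = Comp 𝕜 V D r :=
  tail_comp_comp 𝕜 r V D r.zero_le

/-- The sum defining `SumMap` telescopes on families of the form `D_j S_j - S_{j+1}`. -/
theorem sumMap_sub (S : ∀ i, V i) :
    SumMap 𝕜 r V D (fun j => D j (S j) - S (j + 1)) = Comp 𝕜 V D r (S 0) - S r := by
  have key : SumMap 𝕜 r V D (fun j => D j (S j) - S (j + 1)) =
      ∑ j : Fin r, (Tail 𝕜 r V D j (S j) - Tail 𝕜 r V D (j + 1) (S (j + 1))) := by
    simp only [SumMap, LinearMap.sum_apply, LinearMap.comp_apply, LinearMap.proj_apply, map_sub]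
    refine Finset.sum_congr rfl fun j _ => ?_
    rw [tail_of_lt 𝕜 r V D j.2, LinearMap.comp_apply]
  rw [key, Fin.sum_univ_eq_sum_range
    (fun j => Tail 𝕜 r V D j (S j) - Tail 𝕜 r V D (j + 1) (S (j + 1))) r,
    Finset.sum_range_sub' (fun j => Tail 𝕜 r V D j (S j)), tail_zero, tail_self,
    LinearMap.id_apply]

theorem dhat_restrict (S : ∀ i, V i) (hS : S r = 0) :
    Dhat 𝕜 r V D (fun i => S i) = fun j : Fin r => D j (S j) - S (j + 1) := by
  funext j
  change D j (S j) - (if _ : (j : ℕ) + 1 < r then S (j + 1) else 0) = _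
  split_ifs with h
  · rfl
  · have hj : (j : ℕ) + 1 = r := by omega
    have hz : S (j + 1) = 0 := by rw [hj]; exact hS
    rw [hz]

theorem sumMap_surjective_mod_range :
    Function.Surjective ((LinearMap.range (Comp 𝕜 V D r)).mkQ.comp (SumMap 𝕜 r V D)) := by
  intro q
  obtain ⟨x, rfl⟩ := Submodule.mkQ_surjective _ q
  let S : ∀ i, V i := Pi.single r (-x)
  refine ⟨fun j => D j (S j) - S (j + 1), ?_⟩
  rw [LinearMap.comp_apply, sumMap_sub, ← sub_eq_zero, ← map_sub, ← LinearMap.mem_ker,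
    Submodule.ker_mkQ]
  exact ⟨S 0, by simp [S]⟩

/-- The solution of `S_{j+1} = D_j S_j - w_j` with initial value `v`. -/
def recSol (v : V 0) (w : ∀ j : ℕ, V (j + 1)) : ∀ i, V i
  | 0 => v
  | i + 1 => D i (recSol v w i) - w i

theorem ker_mkQ_comp_sumMap :
    LinearMap.ker ((LinearMap.range (Comp 𝕜 V D r)).mkQ.comp (SumMap 𝕜 r V D)) =
      LinearMap.range (Dhat 𝕜 r V D) := by
  rw [LinearMap.ker_comp, Submodule.ker_mkQ]
  apply le_antisymm
  · rintro w ⟨v, hv⟩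
    let S := recSol 𝕜 V D v fun j => if h : j < r then w ⟨j, h⟩ else 0
    have hw : (fun j : Fin r => D j (S j) - S (j + 1)) = w := by
      funext j
      simp [S, recSol]
    have hS : S r = 0 := by
      have h := sumMap_sub 𝕜 r V D S
      rw [hw, ← hv] at h
      exact sub_eq_self.mp h.symm
    exact ⟨fun i => S i, by rw [dhat_restrict 𝕜 r V D S hS, hw]⟩
  · rintro _ ⟨s, rfl⟩
    let S : ∀ i, V i := fun i => if h : i < r then s ⟨i, h⟩ else 0
    have hS : S r = 0 := dif_neg (lt_irrefl r)
    have hs : (fun i : Fin r => S i) = s := by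
      funext i
      simp [S]
    rw [← hs, dhat_restrict 𝕜 r V D S hS, Submodule.mem_comap, sumMap_sub, hS, sub_zero]
    exact ⟨S 0, rfl⟩

/-- The map `(w_r, …, w₁) ↦ [w_r + ∑_{i=1}^{r-1} (D_{r-1} ∘ ⋯ ∘ Dᵢ)(wᵢ)] ∈ V_r / range 𝐃`
is surjective with kernel exactly `range D̂`, and hence induces a `𝕜`-linear isomorphism
`(V_r ⊕ ⋯ ⊕ V₁) / range D̂ ≅ V_r / range 𝐃`. -/
theorem statement3 :
    Function.Surjective
      ((LinearMap.range (Comp 𝕜 V D r)).mkQ.comp (SumMap 𝕜 r V D)) ∧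
    LinearMap.ker ((LinearMap.range (Comp 𝕜 V D r)).mkQ.comp (SumMap 𝕜 r V D)) =
      LinearMap.range (Dhat 𝕜 r V D) ∧
    ∃ e : ((∀ j : Fin r, V ((j : ℕ) + 1)) ⧸ LinearMap.range (Dhat 𝕜 r V D)) ≃ₗ[𝕜]
        (V r ⧸ LinearMap.range (Comp 𝕜 V D r)),
      ∀ w : ∀ j : Fin r, V ((j : ℕ) + 1),
        e (Submodule.Quotient.mk w) = Submodule.Quotient.mk (SumMap 𝕜 r V D w) := by
  have hsurj := sumMap_surjective_mod_range 𝕜 r V D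
  have hker := ker_mkQ_comp_sumMap 𝕜 r V D
  exact ⟨hsurj, hker, (Submodule.quotEquivOfEq _ _ hker.symm).trans
    (LinearMap.quotKerEquivOfSurjective _ hsurj), fun _ => rfl⟩

end RelZeta
end

section
/- Let B₀, …, B_{r−1} be 𝕜-vector spaces, γᵢ : Vᵢ → Bᵢ 𝕜-linear maps (the 'boundary trace maps') and Pᵢ : Bᵢ → Bᵢ idempotent 𝕜-linear maps (the 'boundary conditions') for i = 0, …, r−1. Suppose the doubled-up boundary value problem D̂_P, namely the restriction of D̂ to {(s₀, …, s_{r−1}) : Pᵢ(γᵢ(sᵢ)) = 0 for all i}, is a bijection onto V_r ⊕ V_{r−1} ⊕ ⋯ ⊕ V₁. Then the r-th order boundary value problem 𝐃_P, namely the restriction of 𝐃 to {s ∈ V₀ : Pᵢ(γᵢ(Cᵢ s)) = 0 for all i}, is a bijection onto V_r, and for every w ∈ V_r the inverse is given by the (1,1)-block formula: 𝐃_P^{−1} w equals the V₀-component of D̂_P^{−1}(w, 0, …, 0). -/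
namespace RelZeta

variable (𝕜 : Type*) [Field 𝕜] (r : ℕ) (V : ℕ → Type*)
  [∀ i, AddCommGroup (V i)] [∀ i, Module 𝕜 (V i)]
  (D : ∀ i : ℕ, V i →ₗ[𝕜] V (i + 1))

/-- The inclusion `w ↦ (w, 0, …, 0)` of `V_r` into `V_r ⊕ V_{r-1} ⊕ ⋯ ⊕ V₁`
as the top component (the component of index `j = r-1`, valued in `V r`). -/
def TopIncl (hr : 0 < r) : V r →ₗ[𝕜] ∀ j : Fin r, V ((j : ℕ) + 1) :=
  (LinearMap.single 𝕜 (fun j : Fin r => V ((j : ℕ) + 1)) ⟨r - 1, by omega⟩).comp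
    (vcast 𝕜 V (by omega : r = (r - 1) + 1)).toLinearMap

section

variable {𝕜 V}

theorem dhat_apply_of_lt (x : ∀ i : Fin r, V i) (j : Fin r) (h : (j : ℕ) + 1 < r) :
    Dhat 𝕜 r V D x j = D j (x j) - x ⟨(j : ℕ) + 1, h⟩ :=
  congrArg (D j (x j) - ·) (dif_pos h)

theorem dhat_apply_of_not_lt (x : ∀ i : Fin r, V i) (j : Fin r) (h : ¬ (j : ℕ) + 1 < r) :
    Dhat 𝕜 r V D x j = D j (x j) :=
  (congrArg (D j (x j) - ·) (dif_neg h)).trans (sub_zero _)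

theorem topIncl_succ_last (n : ℕ) (hr : 0 < n + 1) (w : V (n + 1)) (h : n < n + 1) :
    TopIncl 𝕜 (n + 1) V hr w ⟨n, h⟩ = w :=
  Pi.single_eq_same (M := fun j : Fin (n + 1) => V ((j : ℕ) + 1)) ⟨n, h⟩ w

theorem topIncl_succ_of_lt (n : ℕ) (hr : 0 < n + 1) (w : V (n + 1)) (j : Fin (n + 1))
    (hj : (j : ℕ) < n) : TopIncl 𝕜 (n + 1) V hr w j = 0 :=
  Pi.single_eq_of_ne (M := fun j : Fin (n + 1) => V ((j : ℕ) + 1)) (i := ⟨n, n.lt_succ_self⟩)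
    (fun h => hj.ne (congrArg Fin.val h)) w

/-- Solving `D̂ x = (w, 0, …, 0)` amounts to `x = (C₀ s, …, C_{r-1} s)` with `𝐃 s = w`. -/
theorem dhat_eq_topIncl_iff (hr : 0 < r) (x : ∀ i : Fin r, V i) (w : V r) :
    Dhat 𝕜 r V D x = TopIncl 𝕜 r V hr w ↔
      (∀ i : Fin r, x i = Comp 𝕜 V D i (x ⟨0, hr⟩)) ∧ Comp 𝕜 V D r (x ⟨0, hr⟩) = w := by
  obtain _ | n := r
  · exact absurd hr (lt_irrefl 0)
  constructor
  · intro h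
    have hx : ∀ i (hi : i < n + 1), x ⟨i, hi⟩ = Comp 𝕜 V D i (x ⟨0, hr⟩) := by
      intro i
      induction i with
      | zero => intro _; rfl
      | succ i ih =>
        intro hi
        have hj := congrFun h ⟨i, by omega⟩
        rw [topIncl_succ_of_lt n hr w _ (by simpa using hi), dhat_apply_of_lt _ _ _ _ hi] at hj
        rw [← sub_eq_zero.1 hj, ih]
        rfl
    refine ⟨fun i => hx i i.2, ?_⟩
    have hn := congrFun h ⟨n, n.lt_succ_self⟩
    rw [topIncl_succ_last, dhat_apply_of_not_lt _ _ _ _ (lt_irrefl _)] at hn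
    rw [← hn, hx n]
    rfl
  · rintro ⟨hx, rfl⟩
    funext j
    obtain ⟨j, hj⟩ := j
    obtain hlt | rfl := Nat.lt_succ_iff_lt_or_eq.1 hj
    · have hj' : j + 1 < n + 1 := by omega
      rw [topIncl_succ_of_lt n hr _ _ hlt, dhat_apply_of_lt _ _ _ _ hj', hx ⟨j, hj⟩,
        hx ⟨j + 1, hj'⟩]
      exact sub_self _
    · rw [topIncl_succ_last, dhat_apply_of_not_lt _ _ _ _ (lt_irrefl _), hx ⟨j, hj⟩]
      rfl

end

/-- Suppose the doubled-up boundary value problem `D̂_P` (the restriction of `D̂` to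
`{(s₀,…,s_{r-1}) : ∀ i, Pᵢ(γᵢ(sᵢ)) = 0}`) is a bijection onto `V_r ⊕ ⋯ ⊕ V₁`. Then
the `r`-th order boundary value problem `𝐃_P` (the restriction of `𝐃` to
`{s ∈ V₀ : ∀ i, Pᵢ(γᵢ(Cᵢ s)) = 0}`) is a bijection onto `V_r`, and the inverse is
given by the `(1,1)`-block formula: `𝐃_P⁻¹ w` is the `V₀`-component of
`D̂_P⁻¹(w, 0, …, 0)`. -/
theorem statement14 (hr : 0 < r) (Bd : ℕ → Type*)
    [∀ i, AddCommGroup (Bd i)] [∀ i, Module 𝕜 (Bd i)]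
    (γ : ∀ i : ℕ, V i →ₗ[𝕜] Bd i) (P : ∀ i : ℕ, Bd i →ₗ[𝕜] Bd i)
    (hPidem : ∀ i : Fin r, (P i).comp (P i) = P i)
    (hbij : Function.Bijective ((Dhat 𝕜 r V D).comp
      (⨅ i : Fin r, LinearMap.ker ((P i).comp ((γ i).comp
        (LinearMap.proj (φ := fun i : Fin r => V i) i)))).subtype)) :
    Function.Bijective ((Comp 𝕜 V D r).comp
      (⨅ i : Fin r, LinearMap.ker ((P i).comp ((γ i).comp (Comp 𝕜 V D i)))).subtype) ∧
    ∀ w : V r,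
      ∀ shat : ↥(⨅ i : Fin r, LinearMap.ker ((P i).comp ((γ i).comp
          (LinearMap.proj (φ := fun i : Fin r => V i) i)))),
        ∀ s : ↥(⨅ i : Fin r, LinearMap.ker ((P i).comp ((γ i).comp (Comp 𝕜 V D i)))),
          Dhat 𝕜 r V D (shat : ∀ i : Fin r, V i) = TopIncl 𝕜 r V hr w →
            Comp 𝕜 V D r (s : V 0) = w →
              (s : V 0) = (shat : ∀ i : Fin r, V i) ⟨0, hr⟩ := by
  have key (s : V 0)
      (hs : s ∈ ⨅ i : Fin r, LinearMap.ker ((P i).comp ((γ i).comp (Comp 𝕜 V D i))))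
      (x : ↥(⨅ i : Fin r, LinearMap.ker ((P i).comp ((γ i).comp
        (LinearMap.proj (φ := fun i : Fin r => V i) i)))))
      (hx : Dhat 𝕜 r V D (x : ∀ i : Fin r, V i) = TopIncl 𝕜 r V hr (Comp 𝕜 V D r s)) :
      s = (x : ∀ i : Fin r, V i) ⟨0, hr⟩ := by
    have hy : (fun i : Fin r => Comp 𝕜 V D i s) ∈ ⨅ i : Fin r, LinearMap.ker ((P i).comp
        ((γ i).comp (LinearMap.proj (φ := fun i : Fin r => V i) i))) := by
      simpa [Submodule.mem_iInf] using hs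
    have hyx : (⟨_, hy⟩ : ↥(⨅ i : Fin r, LinearMap.ker ((P i).comp ((γ i).comp
        (LinearMap.proj (φ := fun i : Fin r => V i) i))))) = x :=
      hbij.1 (((dhat_eq_topIncl_iff r D hr _ _).2 ⟨fun _ => rfl, rfl⟩).trans hx.symm)
    rw [← hyx]
    rfl
  refine ⟨⟨?_, fun w => ?_⟩, fun w x s hx hs => key s s.2 x (hs ▸ hx)⟩
  · intro s t hst
    obtain ⟨x, hx⟩ := hbij.2 (TopIncl 𝕜 r V hr (Comp 𝕜 V D r s))
    have hst' : Comp 𝕜 V D r s = Comp 𝕜 V D r t := hst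
    exact Subtype.ext ((key s s.2 x hx).trans (key t t.2 x (hst' ▸ hx)).symm)
  · obtain ⟨x, hx⟩ := hbij.2 (TopIncl 𝕜 r V hr w)
    obtain ⟨hC, hw⟩ := (dhat_eq_topIncl_iff r D hr _ _).1 hx
    refine ⟨⟨(x : ∀ i : Fin r, V i) ⟨0, hr⟩, ?_⟩, hw⟩
    have hxP := x.2
    simp only [Submodule.mem_iInf, LinearMap.mem_ker, LinearMap.comp_apply,
      LinearMap.proj_apply] at hxP ⊢
    intro i
    exact (congrArg (fun v => P i (γ i v)) (hC i)).symm.trans (hxP i)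

end RelZeta
end
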